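/- For every even integer k ≥ 6, the following identity holds in ℚ[[q]]: ((k+1)·(k−1)·(k−6)/12)·G̃_k = Σ (k_1−1)·(k_2−1)·G̃_{k_1}·G̃_{k_2}, where the sum runs over all ordered pairs (k_1,k_2) of even integers with k_1, k_2 ≥ 4 and k_1 + k_2 = k. (This is the Eisenstein realization of Corollary 4.2 ii).) -/

import Mathlib

/-- The normalized Eisenstein series `G̃_k = -B_k/(2·k!) + ∑_{n≥1} (σ_{k-1}(n)/(k-1)!) q^n`. -/
noncomputable def Gtil (k : ℕ) : PowerSeries ℚ :=
  PowerSeries.mk fun n =>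
    if n = 0 then -(bernoulli k) / (2 * Nat.factorial k)
    else (∑ d ∈ Nat.divisors n, (d : ℚ) ^ (k - 1)) / (Nat.factorial (k - 1))

open scoped Nat PowerSeries

/-- The Taylor series at `0` of a function `f : ℂ → ℂ`, as a formal power series. -/
noncomputable def taylorSeries (f : ℂ → ℂ) : PowerSeries ℂ :=
  PowerSeries.mk fun n => iteratedDeriv n f 0 / n !

@[simp]
lemma coeff_taylorSeries (f : ℂ → ℂ) (n : ℕ) :
    PowerSeries.coeff n (taylorSeries f) = iteratedDeriv n f 0 / n ! :=
  PowerSeries.coeff_mk _ _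

lemma taylorSeries_add {f g : ℂ → ℂ} (hf : AnalyticAt ℂ f 0) (hg : AnalyticAt ℂ g 0) :
    taylorSeries (f + g) = taylorSeries f + taylorSeries g := by
  ext n
  simp [iteratedDeriv_add hf.contDiffAt hg.contDiffAt, add_div]

lemma taylorSeries_mul {f g : ℂ → ℂ} (hf : AnalyticAt ℂ f 0) (hg : AnalyticAt ℂ g 0) :
    taylorSeries (f * g) = taylorSeries f * taylorSeries g := by
  ext n
  rw [coeff_taylorSeries, iteratedDeriv_mul hf.contDiffAt hg.contDiffAt, PowerSeries.coeff_mul,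
    Finset.Nat.sum_antidiagonal_eq_sum_range_succ
      (fun i j => PowerSeries.coeff i (taylorSeries f) * PowerSeries.coeff j (taylorSeries g)),
    Finset.sum_div]
  refine Finset.sum_congr rfl fun i hi => ?_
  rw [Nat.cast_choose ℂ (Finset.mem_range_succ_iff.mp hi), coeff_taylorSeries, coeff_taylorSeries]
  have := Nat.factorial_ne_zero
  field_simp [this]

lemma taylorSeries_const (c : ℂ) : taylorSeries (fun _ => c) = PowerSeries.C c := by
  ext n
  rcases n with _ | n <;> simp [iteratedDeriv_const, PowerSeries.coeff_C]

lemma taylorSeries_pow_id (m : ℕ) : taylorSeries (fun z => z ^ m) = PowerSeries.X ^ m := by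
  ext n
  rw [coeff_taylorSeries, iteratedDeriv_fun_pow_zero, PowerSeries.coeff_X_pow]
  split_ifs <;> simp_all [Nat.factorial_ne_zero]

lemma coeff_X_mul_derivative (f : PowerSeries ℂ) (n : ℕ) :
    PowerSeries.coeff n (PowerSeries.X * d⁄dX ℂ f) = n * PowerSeries.coeff n f := by
  rcases n with _ | n
  · simp
  · rw [PowerSeries.coeff_succ_X_mul, PowerSeries.coeff_derivative]
    push_cast
    ring

/-- The second-order Weierstrass equation, by formal differentiation of the cubic relation. -/
lemma weierstrass_second_order {P Q : PowerSeries ℂ} {a b : ℂ}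
    (hQ : Q = PowerSeries.X * d⁄dX ℂ P - 2 * P) (hQ0 : Q ≠ 0)
    (h : Q ^ 2 = 4 * P ^ 3 - PowerSeries.C a * (PowerSeries.X ^ 4 * P)
      - PowerSeries.C b * PowerSeries.X ^ 6) :
    2 * (PowerSeries.X * d⁄dX ℂ Q - 3 * Q) = 12 * P ^ 2 - PowerSeries.C a * PowerSeries.X ^ 4 := by
  have hd := congrArg (d⁄dX ℂ) h
  have e2 : d⁄dX ℂ (4 : PowerSeries ℂ) = 0 := by
    exact_mod_cast (d⁄dX ℂ).map_natCast 4
  simp only [map_sub, Derivation.leibniz, Derivation.leibniz_pow, PowerSeries.derivative_C,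
    PowerSeries.derivative_X, e2, smul_eq_mul, nsmul_eq_mul] at hd
  push_cast at hd
  norm_num at hd
  apply mul_left_cancel₀ hQ0
  linear_combination PowerSeries.X * hd - 6 * h +
    (12 * P ^ 2 - PowerSeries.C a * PowerSeries.X ^ 4) * (-hQ)

namespace PeriodPair

variable (L : PeriodPair)

/-- The formal Taylor series of `z ^ 2 * ℘(z) - 1` at `0`. -/
noncomputable def laurentTail : PowerSeries ℂ :=
  taylorSeries (L.weierstrassPExcept 0) * PowerSeries.X ^ 2

lemma coeff_laurentTail_add_three (m : ℕ) :
    PowerSeries.coeff (m + 3) L.laurentTail = ((m : ℂ) + 2) * L.G (m + 3) := by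
  have hfac : ((m + 1)! : ℂ) ≠ 0 := mod_cast Nat.factorial_ne_zero _
  rw [laurentTail, PowerSeries.coeff_mul_X_pow', if_pos (by omega), coeff_taylorSeries,
    iteratedDeriv_weierstrassPExcept_self, show m + 3 - 2 = m + 1 by omega, if_neg (by omega),
    sumInvPow_zero, Nat.factorial_succ (m + 1)]
  push_cast
  field_simp
  ring

lemma coeff_laurentTail_of_lt_three {n : ℕ} (hn : n < 3) :
    PowerSeries.coeff n L.laurentTail = 0 := by
  rw [laurentTail, PowerSeries.coeff_mul_X_pow']
  split_ifs with h
  · obtain rfl : n = 2 := by omega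
    simp
  · rfl

lemma coeff_laurentTail (n : ℕ) :
    PowerSeries.coeff n L.laurentTail =
      if Even n ∧ 4 ≤ n then ((n : ℂ) - 1) * L.G n else 0 := by
  rcases lt_or_ge n 3 with h | h
  · rw [L.coeff_laurentTail_of_lt_three h, if_neg (by omega)]
  obtain ⟨m, rfl⟩ := Nat.exists_eq_add_of_le' h
  rw [coeff_laurentTail_add_three]
  split_ifs with h
  · push_cast
    ring
  · rw [L.G_eq_zero_of_odd _ (by grind), mul_zero]

lemma derivWeierstrassPExcept_zero_relation :
    (fun z ↦ (L.derivWeierstrassPExcept 0 z * z ^ 3 + -2) ^ 2) =ᶠ[nhds 0]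
      fun z ↦ 4 * (L.weierstrassPExcept 0 z * z ^ 2 + 1) ^ 3 +
        (-L.g₂ * (z ^ 4 * (L.weierstrassPExcept 0 z * z ^ 2 + 1)) + -L.g₃ * z ^ 6) := by
  filter_upwards [L.compl_lattice_sdiff_singleton_mem_nhds 0] with z hz
  by_cases hz0 : z = 0
  · simp [hz0]; norm_num
  have hz' : z ∉ L.lattice := by simp_all
  have h := L.derivWeierstrassP_sq z hz'
  have h1 := L.derivWeierstrassPExcept_def 0 z
  have h2 := L.weierstrassPExcept_def 0 z
  simp only [ZeroMemClass.coe_zero, sub_zero] at h1 h2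
  rw [h1, h2]
  field_simp
  linear_combination z ^ 6 * h

lemma laurentTail_relation {Q : PowerSeries ℂ}
    (hQ : Q = PowerSeries.X * d⁄dX ℂ (L.laurentTail + 1) - 2 * (L.laurentTail + 1)) :
    Q ^ 2 = 4 * (L.laurentTail + 1) ^ 3
      - PowerSeries.C L.g₂ * (PowerSeries.X ^ 4 * (L.laurentTail + 1))
      - PowerSeries.C L.g₃ * PowerSeries.X ^ 6 := by
  have hQ' : Q = taylorSeries (L.derivWeierstrassPExcept 0) * PowerSeries.X ^ 3
      + PowerSeries.C (-2) := by
    ext n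
    have h2 : (2 : PowerSeries ℂ) = PowerSeries.C 2 := (map_ofNat _ 2).symm
    rw [hQ, h2, map_sub, coeff_X_mul_derivative, PowerSeries.coeff_C_mul, map_add, map_add,
      PowerSeries.coeff_mul_X_pow', PowerSeries.coeff_one, PowerSeries.coeff_C]
    rcases lt_or_ge n 3 with h | h
    · rw [L.coeff_laurentTail_of_lt_three h, if_neg (not_le.mpr h)]
      interval_cases n <;> simp
    obtain ⟨m, rfl⟩ := Nat.exists_eq_add_of_le' h
    have hfac : (m ! : ℂ) ≠ 0 := mod_cast Nat.factorial_ne_zero _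
    rw [coeff_laurentTail_add_three, if_neg (Nat.succ_ne_zero _),
      if_neg (Nat.succ_ne_zero _), if_pos h, Nat.add_sub_cancel, coeff_taylorSeries,
      iteratedDeriv_derivWeierstrassPExcept_self,
      sumInvPow_zero, Nat.factorial_succ (m + 1), Nat.factorial_succ m]
    push_cast
    field_simp
    ring
  have hp := L.analyticAt_weierstrassPExcept 0
  have hd := L.analyticAt_derivWeierstrassPExcept 0
  have key : taylorSeries ((L.derivWeierstrassPExcept 0 * (fun z ↦ z ^ 3) + fun _ ↦ -2) *
        (L.derivWeierstrassPExcept 0 * (fun z ↦ z ^ 3) + fun _ ↦ -2)) =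
      taylorSeries ((fun _ ↦ 4) * ((L.weierstrassPExcept 0 * (fun z ↦ z ^ 2) + fun _ ↦ 1) *
        ((L.weierstrassPExcept 0 * (fun z ↦ z ^ 2) + fun _ ↦ 1) *
        (L.weierstrassPExcept 0 * (fun z ↦ z ^ 2) + fun _ ↦ 1))) +
        ((fun _ ↦ -L.g₂) * ((fun z ↦ z ^ 4) *
          (L.weierstrassPExcept 0 * (fun z ↦ z ^ 2) + fun _ ↦ 1)) +
        (fun _ ↦ -L.g₃) * fun z ↦ z ^ 6)) := by
    ext n
    rw [coeff_taylorSeries, coeff_taylorSeries]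
    congr 1
    apply Filter.EventuallyEq.iteratedDeriv_eq
    filter_upwards [L.derivWeierstrassPExcept_zero_relation] with z hz
    simp only [Pi.mul_apply, Pi.add_apply]
    linear_combination hz
  have hX (m : ℕ) : AnalyticAt ℂ (fun z : ℂ ↦ z ^ m) 0 := by fun_prop
  have hc (c : ℂ) : AnalyticAt ℂ (fun _ : ℂ ↦ c) 0 := analyticAt_const
  have hP := (hp.mul (hX 2)).add (hc 1)
  have hD := (hd.mul (hX 3)).add (hc (-2))
  rw [taylorSeries_mul hD hD, taylorSeries_add (hd.mul (hX 3)) (hc (-2)),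
    taylorSeries_mul hd (hX 3), taylorSeries_add ((hc 4).mul (hP.mul (hP.mul hP)))
      (((hc _).mul ((hX 4).mul hP)).add ((hc _).mul (hX 6))),
    taylorSeries_add ((hc _).mul ((hX 4).mul hP)) ((hc _).mul (hX 6)),
    taylorSeries_mul (hc _) (hP.mul (hP.mul hP)), taylorSeries_mul hP (hP.mul hP),
    taylorSeries_mul hP hP, taylorSeries_mul (hc _) ((hX 4).mul hP), taylorSeries_mul (hX 4) hP,
    taylorSeries_mul (hc _) (hX 6), taylorSeries_add (hp.mul (hX 2)) (hc 1),
    taylorSeries_mul hp (hX 2)] at key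
  simp only [taylorSeries_const, taylorSeries_pow_id] at key
  rw [← hQ', ← laurentTail] at key
  have h4 : PowerSeries.C (4 : ℂ) = 4 := map_ofNat _ 4
  simp only [map_neg, map_one, h4] at key
  linear_combination key

/-- The quadratic recursion for the lattice Eisenstein sums, from the second-order differential
equation of the Weierstrass function. -/
lemma G_recursion {k : ℕ} (hk : Even k) (h6 : 6 ≤ k) :
    ((k : ℂ) + 1) * ((k : ℂ) - 6) * (((k : ℂ) - 1) * L.G k) =
      6 * ∑ p ∈ Finset.HasAntidiagonal.antidiagonal k,
        PowerSeries.coeff p.1 L.laurentTail * PowerSeries.coeff p.2 L.laurentTail := by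
  set Q : PowerSeries ℂ :=
    PowerSeries.X * d⁄dX ℂ (L.laurentTail + 1) - 2 * (L.laurentTail + 1) with hQ
  have hQ0 : Q ≠ 0 := by
    intro h
    have := congrArg PowerSeries.constantCoeff (hQ.symm.trans h)
    have h0 : PowerSeries.constantCoeff L.laurentTail = 0 := by simp [laurentTail]
    have h2 : (2 : PowerSeries ℂ) = PowerSeries.C 2 := (map_ofNat _ 2).symm
    simp [h0, h2] at this
  have h := congrArg (PowerSeries.coeff k)
    (weierstrass_second_order hQ hQ0 (L.laurentTail_relation hQ))
  have hE : PowerSeries.coeff k L.laurentTail = ((k : ℂ) - 1) * L.G k := by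
    rw [coeff_laurentTail, if_pos ⟨hk, by omega⟩]
  have h2 : (2 : PowerSeries ℂ) = PowerSeries.C 2 := (map_ofNat _ 2).symm
  have h3 : (3 : PowerSeries ℂ) = PowerSeries.C 3 := (map_ofNat _ 3).symm
  have h12 : (12 : PowerSeries ℂ) = PowerSeries.C 12 := (map_ofNat _ 12).symm
  rw [show (12 : PowerSeries ℂ) * (L.laurentTail + 1) ^ 2 = 12 * (L.laurentTail * L.laurentTail) +
    12 * (2 * L.laurentTail) + 12 * 1 by ring, h12, h3, h2] at h
  have hQk : PowerSeries.coeff k Q = ((k : ℂ) - 2) * (((k : ℂ) - 1) * L.G k) := by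
    rw [hQ, h2, map_sub, coeff_X_mul_derivative, PowerSeries.coeff_C_mul, map_add, hE,
      PowerSeries.coeff_one, if_neg (by omega)]
    ring
  simp only [map_sub, map_add, PowerSeries.coeff_C_mul, coeff_X_mul_derivative, hQk, hE,
    PowerSeries.coeff_one, PowerSeries.coeff_X_pow, if_neg (show k ≠ 0 by omega),
    if_neg (show k ≠ 4 by omega)] at h
  rw [PowerSeries.coeff_mul] at h
  linear_combination h / 2

end PeriodPair

open UpperHalfPlane in
/-- The pair of periods `(τ, 1)`. -/
noncomputable def UpperHalfPlane.periodPair (τ : ℍ) : PeriodPair where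
  ω₁ := τ
  ω₂ := 1
  indep := by
    rw [LinearIndependent.pair_iff]
    intro s t h
    have him := congrArg Complex.im h
    have hre := congrArg Complex.re h
    have hτ := τ.im_ne_zero
    simp at him hre
    have hs : s = 0 := by tauto
    subst hs
    simpa using hre

open UpperHalfPlane EisensteinSeries in
lemma UpperHalfPlane.G_periodPair_eq_tsum_eisSummand (τ : ℍ) (k : ℕ) :
    τ.periodPair.G k = ∑' v : Fin 2 → ℤ, eisSummand k v τ := by
  rw [PeriodPair.G, ← τ.periodPair.latticeEquivProd.symm.toEquiv.tsum_eq,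
    ← (finTwoArrowEquiv ℤ).tsum_eq]
  refine tsum_congr fun v => ?_
  have := τ.periodPair.latticeEquiv_symm_apply (finTwoArrowEquiv ℤ v)
  simp only [LinearEquiv.coe_toEquiv, this]
  simp [eisSummand, periodPair]

open Complex Real in
lemma riemannZeta_of_even {k : ℕ} (hk : Even k) (hk0 : k ≠ 0) :
    riemannZeta k = (2 * π * Complex.I) ^ k * (-(bernoulli k : ℂ) / (2 * k !)) := by
  obtain ⟨m, rfl⟩ := even_iff_exists_two_mul.mp hk
  have hm : m ≠ 0 := by omega
  rw [Nat.cast_mul, Nat.cast_two, riemannZeta_two_mul_nat hm, mul_pow, mul_pow, pow_mul I, I_sq]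
  obtain ⟨j, rfl⟩ := Nat.exists_eq_succ_of_ne_zero hm
  rw [show 2 * (j + 1) - 1 = 2 * j + 1 by omega, show 2 * (j + 1) = 2 * j + 1 + 1 by ring]
  field_simp
  ring

/-- `HasEval f q a` says that the rational power series `f` converges to `a` at `q`. -/
def HasEval (f : PowerSeries ℚ) (q a : ℂ) : Prop :=
  HasSum (fun n : ℕ ↦ ((PowerSeries.coeff n f : ℚ) : ℂ) * q ^ n) a

open Complex Real UpperHalfPlane EisensteinSeries in
lemma hasEval_Gtil {k : ℕ} (hk : Even k) (hk4 : 4 ≤ k) (τ : ℍ) :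
    HasEval (Gtil k) (cexp (2 * π * Complex.I * τ))
      (τ.periodPair.G k / (2 * (2 * π * Complex.I) ^ k)) := by
  have hs := ((summable_nat_add_iff 1).mpr
    (summable_sigma_mul_cexp_pow (k := k) (by omega) τ)).hasSum
  have hπ : (2 * π * Complex.I : ℂ) ≠ 0 := two_pi_I_ne_zero
  have hfac : ((k - 1)! : ℂ) ≠ 0 := mod_cast Nat.factorial_ne_zero _
  unfold HasEval
  rw [← hasSum_nat_add_iff' 1]
  convert! hs.div_const ((k - 1)! : ℂ) using 1
  · ext n
    simp [Gtil, ArithmeticFunction.sigma_apply]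
    ring
  · rw [G_periodPair_eq_tsum_eisSummand,
      tsum_eisSummand_eq_tsum_sigma_mul_cexp_pow (by omega) hk,
      tsum_pnat_eq_tsum_succ (f := fun n ↦ (ArithmeticFunction.sigma (k - 1) n : ℂ) *
        cexp (2 * π * Complex.I * τ) ^ n), riemannZeta_of_even hk (by omega),
      show (-2 * π * Complex.I : ℂ) = -(2 * π * Complex.I) by ring, hk.neg_pow]
    simp [Gtil]
    field_simp
    ring

open Complex Real UpperHalfPlane in
/-- A power series vanishing at every `exp (2 * π * I * τ)`, `τ` in the upper half-plane, is zero. -/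
lemma eq_zero_of_hasSum_qParam {c : ℕ → ℂ}
    (h : ∀ τ : ℍ, HasSum (fun n ↦ c n * cexp (2 * π * Complex.I * τ) ^ n) 0) (n : ℕ) :
    c n = 0 := by
  have h0 := ModularFormClass.qExpansion_coeff_unique one_pos
    one_mem_strictPeriods_SL
    (f := (0 : ModularForm (Matrix.SpecialLinearGroup.mapGL ℝ).range 4)) (c := c)
    (fun τ ↦ by simpa [Function.Periodic.qParam] using h τ) n
  rw [h0, FunLike.coe_zero, UpperHalfPlane.qExpansion_zero, map_zero]

lemma HasEval.sub {f g : PowerSeries ℚ} {q a b : ℂ} (hf : HasEval f q a) (hg : HasEval g q b) :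
    HasEval (f - g) q (a - b) := by
  unfold HasEval at *
  simpa [sub_mul] using HasSum.sub hf hg

lemma HasEval.smul {f : PowerSeries ℚ} {q a : ℂ} (hf : HasEval f q a) (r : ℚ) :
    HasEval (r • f) q (r * a) := by
  unfold HasEval at *
  simpa [mul_assoc] using HasSum.mul_left (r : ℂ) hf

lemma HasEval.sum {ι : Type*} {s : Finset ι} {f : ι → PowerSeries ℚ} {q : ℂ} {a : ι → ℂ}
    (h : ∀ i ∈ s, HasEval (f i) q (a i)) : HasEval (∑ i ∈ s, f i) q (∑ i ∈ s, a i) := by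
  unfold HasEval at *
  simpa [Finset.sum_mul] using hasSum_sum h

lemma HasEval.mul {f g : PowerSeries ℚ} {q a b : ℂ} (hf : HasEval f q a) (hg : HasEval g q b) :
    HasEval (f * g) q (a * b) := by
  unfold HasEval at *
  have hf' := hf.summable.norm
  have hg' := hg.summable.norm
  have hs := (summable_norm_sum_mul_antidiagonal_of_summable_norm hf' hg').of_norm
  rw [← hf.tsum_eq, ← hg.tsum_eq,
    tsum_mul_tsum_eq_tsum_sum_antidiagonal_of_summable_norm hf' hg']
  have hc : (fun n ↦ ((PowerSeries.coeff n (f * g) : ℚ) : ℂ) * q ^ n) = fun n ↦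
      ∑ p ∈ Finset.HasAntidiagonal.antidiagonal n, ((PowerSeries.coeff p.1 f : ℚ) : ℂ) * q ^ p.1 *
        (((PowerSeries.coeff p.2 g : ℚ) : ℂ) * q ^ p.2) := by
    ext n
    rw [PowerSeries.coeff_mul, Rat.cast_sum, Finset.sum_mul]
    refine Finset.sum_congr rfl fun p hp ↦ ?_
    rw [← Finset.HasAntidiagonal.mem_antidiagonal.mp hp, pow_add, Rat.cast_mul]
    ring
  rw [hc]
  exact hs.hasSum

/-- the Eisenstein realization of Corollary 4.2 ii). -/
theorem stmt_17 (k : ℕ) (hk : Even k) (h6 : 6 ≤ k) :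
    (((k : ℚ) + 1) * ((k : ℚ) - 1) * ((k : ℚ) - 6) / 12) • Gtil k =
      ∑ p ∈ (Finset.range (k + 1) ×ˢ Finset.range (k + 1)).filter
          (fun p => Even p.1 ∧ Even p.2 ∧ 4 ≤ p.1 ∧ 4 ≤ p.2 ∧ p.1 + p.2 = k),
        (((p.1 : ℚ) - 1) * ((p.2 : ℚ) - 1)) • (Gtil p.1 * Gtil p.2) := by
  rw [← sub_eq_zero]
  ext n
  rw [map_zero, ← Rat.cast_inj (α := ℂ), Rat.cast_zero]
  refine eq_zero_of_hasSum_qParam (c := fun n ↦ ((PowerSeries.coeff n _ : ℚ) : ℂ))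
    (fun τ ↦ ?_) n
  have hlhs := HasEval.smul (hasEval_Gtil hk (by omega) τ)
    (((k : ℚ) + 1) * ((k : ℚ) - 1) * ((k : ℚ) - 6) / 12)
  have hrhs := HasEval.sum (s := (Finset.range (k + 1) ×ˢ Finset.range (k + 1)).filter
      (fun p => Even p.1 ∧ Even p.2 ∧ 4 ≤ p.1 ∧ 4 ≤ p.2 ∧ p.1 + p.2 = k)) fun p hp ↦
    have hp' := (Finset.mem_filter.mp hp).2
    ((hasEval_Gtil hp'.1 hp'.2.2.1 τ).mul (hasEval_Gtil hp'.2.1 hp'.2.2.2.1 τ)).smul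
      (((p.1 : ℚ) - 1) * ((p.2 : ℚ) - 1))
  have hmain := hlhs.sub hrhs
  unfold HasEval at hmain
  convert hmain using 1
  have hrec := τ.periodPair.G_recursion hk h6
  have hset : (Finset.range (k + 1) ×ˢ Finset.range (k + 1)).filter
        (fun p => Even p.1 ∧ Even p.2 ∧ 4 ≤ p.1 ∧ 4 ≤ p.2 ∧ p.1 + p.2 = k) =
      (Finset.HasAntidiagonal.antidiagonal k).filter
        (fun p => (Even p.1 ∧ 4 ≤ p.1) ∧ (Even p.2 ∧ 4 ≤ p.2)) := by
    ext p
    simp only [Finset.mem_filter, Finset.mem_product, Finset.mem_range,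
      Finset.HasAntidiagonal.mem_antidiagonal]
    grind
  have hsum : ∑ p ∈ Finset.HasAntidiagonal.antidiagonal k,
        PowerSeries.coeff p.1 τ.periodPair.laurentTail *
          PowerSeries.coeff p.2 τ.periodPair.laurentTail =
      ∑ p ∈ (Finset.HasAntidiagonal.antidiagonal k).filter
        (fun p => (Even p.1 ∧ 4 ≤ p.1) ∧ (Even p.2 ∧ 4 ≤ p.2)),
        (((p.1 : ℂ) - 1) * τ.periodPair.G p.1) * (((p.2 : ℂ) - 1) * τ.periodPair.G p.2) := by
    rw [Finset.sum_filter]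
    refine Finset.sum_congr rfl fun p _ => ?_
    rw [PeriodPair.coeff_laurentTail, PeriodPair.coeff_laurentTail, ite_and, ite_zero_mul_ite_zero]
    split_ifs <;> simp_all
  have hπ : (2 * Real.pi * Complex.I : ℂ) ≠ 0 := Complex.two_pi_I_ne_zero
  rw [hset, eq_comm, sub_eq_zero]
  have hR : ∑ p ∈ (Finset.HasAntidiagonal.antidiagonal k).filter
        (fun p => (Even p.1 ∧ 4 ≤ p.1) ∧ (Even p.2 ∧ 4 ≤ p.2)),
        (((((p.1 : ℚ) - 1) * ((p.2 : ℚ) - 1) : ℚ) : ℂ) *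
          (τ.periodPair.G p.1 / (2 * (2 * Real.pi * Complex.I) ^ p.1) *
            (τ.periodPair.G p.2 / (2 * (2 * Real.pi * Complex.I) ^ p.2)))) =
      (∑ p ∈ (Finset.HasAntidiagonal.antidiagonal k).filter
        (fun p => (Even p.1 ∧ 4 ≤ p.1) ∧ (Even p.2 ∧ 4 ≤ p.2)),
        (((p.1 : ℂ) - 1) * τ.periodPair.G p.1) * (((p.2 : ℂ) - 1) * τ.periodPair.G p.2)) /
          (4 * (2 * Real.pi * Complex.I) ^ k) := by
    rw [Finset.sum_div]
    refine Finset.sum_congr rfl fun p hp => ?_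
    rw [← Finset.HasAntidiagonal.mem_antidiagonal.mp (Finset.mem_filter.mp hp).1, pow_add]
    push_cast
    field_simp
    ring
  rw [hR, ← hsum]
  push_cast
  rw [div_mul_div_comm, div_eq_div_iff (by simp [hπ]) (by simp [hπ])]
  linear_combination 4 * (2 * Real.pi * Complex.I) ^ k * hrec
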